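/- Let n ≥ 2, let Ω ⊂ ℂⁿ be an open set and K ⊂ Ω a compact subset such that Ω \ K is connected. Then every holomorphic function f on Ω \ K has a unique holomorphic extension to Ω. -/

import Mathlib

open Set Filter Topology MeasureTheory Metric

namespace Hartogs

/-- Twice the Cauchy-Riemann operator. -/
noncomputable def dbar (χ : ℂ → ℂ) (ζ : ℂ) : ℂ :=
  fderiv ℝ χ ζ 1 + Complex.I * fderiv ℝ χ ζ Complex.I

lemma eqOn_ball {E : Type*} [NormedAddCommGroup E] [NormedSpace ℂ E] {f g : E → ℂ} {c : E} {r : ℝ}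
    (hf : DifferentiableOn ℂ f (ball c r)) (hg : DifferentiableOn ℂ g (ball c r)) {a : E}
    (ha : a ∈ ball c r) (h : f =ᶠ[𝓝 a] g) : EqOn f g (ball c r) := by
  intro w hw
  let _ : NormedSpace ℝ E := NormedSpace.restrictScalars ℝ ℂ E
  let l : ℂ → E := fun t => a + t • (w - a)
  have hl : Differentiable ℂ l := by
    intro t; fun_prop
  let D : Set ℂ := l ⁻¹' ball c r
  have hDo : IsOpen D := isOpen_ball.preimage hl.continuous
  have hDc : Convex ℝ D := by
    intro x hx y hy s t hs ht hst
    have h1 := convex_ball c r hx hy hs ht hst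
    change l _ ∈ ball c r
    convert h1 using 1
    simp only [l, smul_add, add_smul, smul_assoc]
    have h2 : a = s • a + t • a := by rw [← add_smul, hst, one_smul]
    nth_rewrite 1 [h2]
    abel
  have hd : DifferentiableOn ℂ (fun t => f (l t) - g (l t)) D :=
    (hf.comp hl.differentiableOn (mapsTo_preimage l _)).sub
      (hg.comp hl.differentiableOn (mapsTo_preimage l _))
  have l0 : l 0 = a := by simp [l]
  have l1 : l 1 = w := by simp [l]
  have h0 : (fun t => f (l t) - g (l t)) =ᶠ[𝓝 0] 0 := by
    have : Tendsto l (𝓝 0) (𝓝 a) := by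
      have := hl.continuous.tendsto 0
      rwa [l0] at this
    filter_upwards [this.eventually h] with t ht
    simp [ht]
  have := (hd.analyticOnNhd hDo).eqOn_zero_of_preconnected_of_eventuallyEq_zero
    hDc.isPreconnected (show (0 : ℂ) ∈ D by change l 0 ∈ ball c r; rwa [l0]) h0
    (show (1 : ℂ) ∈ D by change l 1 ∈ ball c r; rwa [l1])
  simpa [l1, sub_eq_zero] using this

lemma closure_inter {E : Type*} [NormedAddCommGroup E] [NormedSpace ℂ E] {f g : E → ℂ} {U : Set E}
    (hU : IsOpen U) (hf : DifferentiableOn ℂ f U) (hg : DifferentiableOn ℂ g U) :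
    closure {z | f =ᶠ[𝓝 z] g} ∩ U ⊆ {z | f =ᶠ[𝓝 z] g} := by
  rintro z ⟨hz, hzU⟩
  obtain ⟨r, hr, hrU⟩ := Metric.isOpen_iff.1 hU z hzU
  obtain ⟨a, ha, hab⟩ := mem_closure_iff_nhds.1 hz _ (ball_mem_nhds z hr)
  have := eqOn_ball (hf.mono hrU) (hg.mono hrU) ha hab
  exact this.eventuallyEq_of_mem (ball_mem_nhds z hr)

lemma isOpen_agree {E : Type*} [NormedAddCommGroup E] [NormedSpace ℂ E] (f g : E → ℂ) :
    IsOpen {z | f =ᶠ[𝓝 z] g} := isOpen_setOfPred_eventually_nhds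

lemma identity {E : Type*} [NormedAddCommGroup E] [NormedSpace ℂ E] {f g : E → ℂ} {U : Set E}
    (hU : IsOpen U) (hc : IsPreconnected U) (hf : DifferentiableOn ℂ f U)
    (hg : DifferentiableOn ℂ g U) {a : E} (ha : a ∈ U) (h : f =ᶠ[𝓝 a] g) : EqOn f g U := by
  have := hc.subset_of_closure_inter_subset (isOpen_agree f g) ⟨a, ha, h⟩ (closure_inter hU hf hg)
  intro z hz
  exact (this hz).eq_of_nhds

lemma uniq {E : Type*} [NormedAddCommGroup E] [NormedSpace ℂ E] [NoncompactSpace E]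
    {f g : E → ℂ} {Ω K : Set E}
    (hΩ : IsOpen Ω) (hK : IsCompact K) (hKΩ : K ⊆ Ω) (hf : DifferentiableOn ℂ f Ω)
    (hg : DifferentiableOn ℂ g Ω) (h : EqOn f g (Ω \ K)) : EqOn f g Ω := by
  let _ : NormedSpace ℝ E := NormedSpace.restrictScalars ℝ ℂ E
  set A := {z | f =ᶠ[𝓝 z] g} with hA
  have hAo : IsOpen A := isOpen_agree f g
  have hcl := closure_inter hΩ hf hg
  have hsub : Ω \ K ⊆ A := fun z hz =>
    h.eventuallyEq_of_mem ((hΩ.sdiff hK.isClosed).mem_nhds hz)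
  have e1 : K \ A = Ω \ closure A := by
    ext z
    constructor
    · rintro ⟨h1, h2⟩
      exact ⟨hKΩ h1, fun h3 => h2 (hcl ⟨h3, hKΩ h1⟩)⟩
    · rintro ⟨h1, h2⟩
      have h3 : z ∉ A := fun h3 => h2 (subset_closure h3)
      refine ⟨?_, h3⟩
      by_contra h4
      exact h3 (hsub ⟨h1, h4⟩)
  have hcomp : IsCompact (K \ A) := hK.diff hAo
  have hclopen : IsClopen (K \ A) :=
    ⟨hcomp.isClosed, by rw [e1]; exact hΩ.sdiff isClosed_closure⟩
  rcases isClopen_iff.1 hclopen with h0 | h0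
  · intro z hz
    by_cases hzK : z ∈ K
    · have : z ∈ A := by
        by_contra h5
        have : z ∈ K \ A := ⟨hzK, h5⟩
        rw [h0] at this; exact this
      exact this.eq_of_nhds
    · exact h ⟨hz, hzK⟩
  · rw [h0] at hcomp
    exact absurd hcomp (noncompact_univ E)

lemma mul_continuous {h ψ : ℂ → ℂ} {U : Set ℂ} (hU : IsOpen U) (hh : ContinuousOn h U)
    (hψ : Continuous ψ) (hs : tsupport ψ ⊆ U) : Continuous (fun ζ => h ζ * ψ ζ) := by
  have h1 : ContinuousOn (fun ζ => h ζ * ψ ζ) U := hh.mul hψ.continuousOn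
  exact h1.continuous_of_tsupport_subset hU ((closure_mono (by
    intro x hx; simp only [Function.mem_support] at hx ⊢; exact right_ne_zero_of_mul hx)).trans hs)

lemma mul_integrable {h ψ : ℂ → ℂ} {U : Set ℂ} (hU : IsOpen U) (hh : ContinuousOn h U)
    (hψ : Continuous ψ) (hc : HasCompactSupport ψ) (hs : tsupport ψ ⊆ U) :
    Integrable (fun ζ => h ζ * ψ ζ) :=
  (mul_continuous hU hh hψ hs).integrable_of_hasCompactSupport hc.mul_left

lemma stokes {h ψ : ℂ → ℂ} {U : Set ℂ} (hU : IsOpen U) (hh : DifferentiableOn ℂ h U)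
    (hψ : ContDiff ℝ 1 ψ) (hc : HasCompactSupport ψ) (hs : tsupport ψ ⊆ U) :
    ∫ ζ, dbar ψ ζ * h ζ = 0 := by
  have hd : ∀ x ∈ U, HasFDerivAt h ((fderiv ℂ h x).restrictScalars ℝ) x := fun x hx =>
    ((hh x hx).differentiableAt (hU.mem_nhds hx)).hasFDerivAt.restrictScalars ℝ
  have hfd : ∀ x ∈ U, ∀ v, fderiv ℝ h x v = v * deriv h x := fun x hx v => by
    rw [(hd x hx).fderiv]
    simp
  have hfc : ∀ v, ContinuousOn (fun x => fderiv ℝ h x v) U := fun v => by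
    refine ContinuousOn.congr (f := fun x => v * deriv h x) ?_ (fun x hx => hfd x hx v)
    exact continuousOn_const.mul (hh.deriv hU).continuousOn
  have hψd : ∀ v, Continuous (fun x => fderiv ℝ ψ x v) := fun v =>
    (hψ.continuous_fderiv one_ne_zero).clm_apply continuous_const
  have hψc : ∀ v, HasCompactSupport (fun x => fderiv ℝ ψ x v) := fun v => by
    exact hc.fderiv_apply ℝ v
  have hψs : ∀ v, tsupport (fun x => fderiv ℝ ψ x v) ⊆ U := fun v =>
    (tsupport_fderiv_apply_subset ℝ v).trans hs
  have hi : ∀ v, Integrable (fun x => h x * fderiv ℝ ψ x v) := fun v =>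
    mul_integrable hU hh.continuousOn (hψd v) (hψc v) (hψs v)
  have key : ∀ v, ∫ x, h x * fderiv ℝ ψ x v = - ∫ x, fderiv ℝ h x v * ψ x := fun v => by
    refine integral_mul_fderiv_eq_neg_fderiv_mul_of_integrable ?_ (hi v) ?_ ?_ ?_
    · exact mul_integrable hU (hfc v) hψ.continuous hc hs
    · exact mul_integrable hU hh.continuousOn hψ.continuous hc hs
    · intro x hx
      exact (hd x (hs hx)).differentiableAt
    · intro x _
      exact (hψ.differentiable one_ne_zero) x
  have e : ∀ ζ, dbar ψ ζ * h ζ =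
      h ζ * fderiv ℝ ψ ζ 1 + Complex.I * (h ζ * fderiv ℝ ψ ζ Complex.I) := fun ζ => by
    unfold dbar; ring
  simp_rw [e]
  rw [integral_add (hi 1) ((hi _).const_mul _), integral_const_mul, key, key]
  rw [mul_neg, ← integral_const_mul, ← neg_add, ← integral_add, neg_eq_zero]
  · rw [← integral_zero ℂ ℂ]
    congr 1
    ext x
    by_cases hx : x ∈ tsupport ψ
    · rw [hfd x (hs hx), hfd x (hs hx)]
      linear_combination deriv h x * ψ x * Complex.I_mul_I
    · simp [image_eq_zero_of_notMem_tsupport hx]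
  · exact mul_integrable hU (hfc _) hψ.continuous hc hs
  · exact (mul_integrable hU (hfc _) hψ.continuous hc hs).const_mul _

lemma exists_cutoff {C U : Set ℂ} (hC : IsCompact C) (hU : IsOpen U) (h : C ⊆ U) :
    ∃ χ : ℂ → ℂ, ContDiff ℝ 1 χ ∧ HasCompactSupport χ ∧ tsupport χ ⊆ U ∧
      Disjoint (tsupport (fun ζ => 1 - χ ζ)) C := by
  obtain ⟨V, hVo, hCV, hVU, hVc⟩ := exists_open_between_and_isCompact_closure hC hU h
  obtain ⟨W, hWo, hCW, hWV, hWc⟩ := exists_open_between_and_isCompact_closure hC hVo hCV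
  obtain ⟨g, hg, -, hgs, hg1⟩ := exists_contMDiff_support_eq_eq_one_iff
    (n := 1) (modelWithCornersSelf ℝ ℂ) hVo isClosed_closure hWV
  have hts : tsupport (fun ζ => (g ζ : ℂ)) = closure V := by
    rw [tsupport, ← hgs]
    congr 1
    ext x
    simp
  refine ⟨fun ζ => (g ζ : ℂ), ?_, ?_, ?_, ?_⟩
  · exact Complex.ofRealCLM.contDiff.comp hg.contDiff
  · rw [HasCompactSupport, hts]; exact hVc
  · rw [hts]; exact hVU
  · have : tsupport (fun ζ => 1 - (g ζ : ℂ)) ⊆ Wᶜ := by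
      refine closure_minimal ?_ hWo.isClosed_compl
      intro x hx hxW
      have := (hg1 x).1 (subset_closure hxW)
      simp [this] at hx
    exact disjoint_left.2 fun x hx hxC => this hx (hCW hxC)

lemma dbar_zero {χ : ℂ → ℂ} {ζ : ℂ} (h : ζ ∉ tsupport χ) : dbar χ ζ = 0 := by
  have : χ =ᶠ[𝓝 ζ] fun _ => 0 := notMem_tsupport_iff_eventuallyEq.1 h
  simp [dbar, this.fderiv_eq]

lemma dbar_zero' {χ : ℂ → ℂ} {ζ : ℂ} (h : ζ ∉ tsupport (fun x => 1 - χ x)) : dbar χ ζ = 0 := by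
  have : (fun x => 1 - χ x) =ᶠ[𝓝 ζ] fun _ => 0 := notMem_tsupport_iff_eventuallyEq.1 h
  have : χ =ᶠ[𝓝 ζ] fun _ => 1 := by
    filter_upwards [this] with x hx
    exact (sub_eq_zero.1 hx).symm
  simp [dbar, this.fderiv_eq]

lemma dbar_continuous {χ : ℂ → ℂ} (h : ContDiff ℝ 1 χ) : Continuous (dbar χ) := by
  have hψd : ∀ v, Continuous (fun x => fderiv ℝ χ x v) := fun v =>
    (h.continuous_fderiv one_ne_zero).clm_apply continuous_const
  exact (hψd 1).add (continuous_const.mul (hψd _))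

lemma dbar_sub {χ₁ χ₂ : ℂ → ℂ} (h₁ : ContDiff ℝ 1 χ₁) (h₂ : ContDiff ℝ 1 χ₂) (ζ : ℂ) :
    dbar (fun x => χ₁ x - χ₂ x) ζ = dbar χ₁ ζ - dbar χ₂ ζ := by
  unfold dbar
  rw [fderiv_fun_sub (h₁.differentiable one_ne_zero ζ) (h₂.differentiable one_ne_zero ζ)]
  simp
  ring

lemma dbar_integrable {χ h : ℂ → ℂ} {U : Set ℂ} (a : ContDiff ℝ 1 χ) (b : HasCompactSupport χ)
    (c : tsupport χ ∩ tsupport (fun x => 1 - χ x) ⊆ U) (hU : IsOpen U) (hh : ContinuousOn h U) :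
    Integrable (fun ζ => dbar χ ζ * h ζ) := by
  have hsub : tsupport (dbar χ) ⊆ tsupport χ ∩ tsupport (fun x => 1 - χ x) := by
    refine closure_minimal ?_ ((isClosed_tsupport _).inter (isClosed_tsupport _))
    intro x hx
    constructor
    · by_contra h; exact hx (dbar_zero h)
    · by_contra h; exact hx (dbar_zero' h)
  simp_rw [mul_comm (dbar χ _)]
  exact mul_integrable hU hh (dbar_continuous a)
    (b.of_isClosed_subset (isClosed_tsupport _) (hsub.trans inter_subset_left)) (hsub.trans c)

/-- independence of the cutoff -/
lemma indep {χ₁ χ₂ h : ℂ → ℂ} {U : Set ℂ} (h₁ : ContDiff ℝ 1 χ₁) (h₂ : ContDiff ℝ 1 χ₂)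
    (c₁ : HasCompactSupport χ₁) (c₂ : HasCompactSupport χ₂)
    (s₁ : tsupport χ₁ ∩ tsupport (fun x => 1 - χ₁ x) ⊆ U)
    (s₂ : tsupport χ₂ ∩ tsupport (fun x => 1 - χ₂ x) ⊆ U)
    (s : (tsupport χ₁ ∪ tsupport χ₂) ∩
      (tsupport (fun x => 1 - χ₁ x) ∪ tsupport (fun x => 1 - χ₂ x)) ⊆ U)
    (hU : IsOpen U) (hh : DifferentiableOn ℂ h U) :
    ∫ ζ, dbar χ₁ ζ * h ζ = ∫ ζ, dbar χ₂ ζ * h ζ := by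
  rw [← sub_eq_zero, ← integral_sub (dbar_integrable h₁ c₁ s₁ hU hh.continuousOn)
    (dbar_integrable h₂ c₂ s₂ hU hh.continuousOn)]
  simp_rw [← sub_mul, ← dbar_sub h₁ h₂]
  refine stokes hU hh (h₁.sub h₂) (c₁.sub c₂) (Subset.trans ?_ s)
  refine closure_minimal ?_ (((isClosed_tsupport _).union (isClosed_tsupport _)).inter
    ((isClosed_tsupport _).union (isClosed_tsupport _)))
  intro x hx
  constructor
  · by_contra h
    simp only [mem_union, not_or] at h
    simp [image_eq_zero_of_notMem_tsupport h.1, image_eq_zero_of_notMem_tsupport h.2] at hx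
  · by_contra h
    simp only [mem_union, not_or] at h
    have a := image_eq_zero_of_notMem_tsupport h.1
    have b := image_eq_zero_of_notMem_tsupport h.2
    apply hx
    linear_combination b - a

lemma radial (w : ℂ) : ∃ ρ : ℂ → ℂ, ContDiff ℝ 1 ρ ∧ HasCompactSupport ρ ∧
    w ∉ tsupport (fun x => 1 - ρ x) ∧ ∫ ζ, dbar ρ ζ * (w - ζ)⁻¹ ≠ 0 := by
  let T := Real.smoothTransition
  have hT : ContDiff ℝ 1 T := Real.smoothTransition.contDiff
  let q : ℂ → ℝ := fun ζ => 2 - ((ζ - w).re ^ 2 + (ζ - w).im ^ 2)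
  have hq : ContDiff ℝ 1 q := by
    have h1 : ContDiff ℝ 1 (fun ζ : ℂ => (ζ - w).re) :=
      Complex.reCLM.contDiff.comp (contDiff_id.sub contDiff_const)
    have h2 : ContDiff ℝ 1 (fun ζ : ℂ => (ζ - w).im) :=
      Complex.imCLM.contDiff.comp (contDiff_id.sub contDiff_const)
    exact contDiff_const.sub ((h1.pow 2).add (h2.pow 2))
  have hqn : ∀ ζ, q ζ = 2 - ‖ζ - w‖ ^ 2 := fun ζ => by
    simp only [q, Complex.sq_norm, Complex.normSq_apply]; ring
  have hqd : ∀ ζ v, fderiv ℝ q ζ v = - (2 * ((ζ - w).re * v.re + (ζ - w).im * v.im)) := by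
    intro ζ v
    have h1 : HasFDerivAt (fun ζ : ℂ => (ζ - w).re) Complex.reCLM ζ :=
      Complex.reCLM.hasFDerivAt.comp ζ ((hasFDerivAt_id ζ).sub_const w)
    have h2 : HasFDerivAt (fun ζ : ℂ => (ζ - w).im) Complex.imCLM ζ :=
      Complex.imCLM.hasFDerivAt.comp ζ ((hasFDerivAt_id ζ).sub_const w)
    have h3 := ((h1.pow 2).add (h2.pow 2)).const_sub 2
    have h4 : fderiv ℝ q ζ = _ := h3.fderiv
    rw [h4]
    simp
    ring
  let ρ : ℂ → ℂ := fun ζ => (T (q ζ) : ℂ)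
  have hρ : ContDiff ℝ 1 ρ := Complex.ofRealCLM.contDiff.comp (hT.comp hq)
  have hρd : ∀ ζ v, fderiv ℝ ρ ζ v = (deriv T (q ζ) * fderiv ℝ q ζ v : ℝ) := by
    intro ζ v
    have h1 := (hT.differentiable one_ne_zero (q ζ)).hasDerivAt.comp_hasFDerivAt ζ
      (hq.differentiable one_ne_zero ζ).hasFDerivAt
    have h2 : HasFDerivAt ρ _ ζ := Complex.ofRealCLM.hasFDerivAt.comp ζ h1
    rw [h2.fderiv]
    simp
  let g : ℂ → ℝ := fun ζ => 2 * deriv T (q ζ)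
  have hgc : Continuous g := continuous_const.mul
    ((hT.continuous_deriv le_rfl).comp hq.continuous)
  have hT0 : ∀ x < 0, deriv T x = 0 := by
    intro x hx
    have : T =ᶠ[𝓝 x] fun _ => 0 := by
      filter_upwards [Iio_mem_nhds hx] with y hy
      exact Real.smoothTransition.zero_of_nonpos (le_of_lt hy)
    rw [this.deriv_eq]; simp
  have hT2 : deriv T 2 = 0 := by
    have : T =ᶠ[𝓝 2] fun _ => 1 := by
      filter_upwards [Ioi_mem_nhds (show (1 : ℝ) < 2 by norm_num)] with y hy
      exact Real.smoothTransition.one_of_one_le (le_of_lt hy)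
    rw [this.deriv_eq]; simp
  have hball : ∀ ζ ∉ closedBall w 2, q ζ < 0 := by
    intro ζ hζ
    rw [mem_closedBall, dist_eq_norm, not_le] at hζ
    rw [hqn]; nlinarith
  have hgs : HasCompactSupport g := HasCompactSupport.intro (isCompact_closedBall w 2)
    (fun ζ hζ => by simp only [g]; rw [hT0 _ (hball ζ hζ), mul_zero])
  have hg0 : 0 ≤ g := fun ζ => by
    have : 0 ≤ deriv T (q ζ) := Real.smoothTransition.monotone.deriv_nonneg
    simp only [g, Pi.zero_apply]; positivity
  have hint : ∀ ζ, dbar ρ ζ * (w - ζ)⁻¹ = (g ζ : ℂ) := by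
    intro ζ
    by_cases h : ζ = w
    · subst h
      have : q ζ = 2 := by simp [q]
      simp [g, this, hT2]
    · have h' : w - ζ ≠ 0 := sub_ne_zero.2 (Ne.symm h)
      rw [← div_eq_mul_inv, div_eq_iff h']
      unfold dbar
      rw [hρd, hρd, hqd, hqd]
      apply Complex.ext
      · simp [g]; ring
      · simp [g]; ring
  refine ⟨ρ, hρ, ?_, ?_, ?_⟩
  · refine HasCompactSupport.intro (isCompact_closedBall w 2) (fun ζ hζ => ?_)
    simp only [ρ, T]
    rw [Real.smoothTransition.zero_of_nonpos (hball ζ hζ).le]; simp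
  · rw [notMem_tsupport_iff_eventuallyEq]
    have : ∀ᶠ ζ in 𝓝 w, 1 < q ζ := by
      apply hq.continuous.continuousAt.eventually (Ioi_mem_nhds _)
      simp [q]
    filter_upwards [this] with ζ hζ
    simp [ρ, T, Real.smoothTransition.one_of_one_le hζ.le]
  · simp_rw [hint]
    rw [integral_complex_ofReal]
    obtain ⟨x, hx, hxT⟩ := exists_deriv_eq_slope T (zero_lt_one) hT.continuous.continuousOn
      (hT.differentiable one_ne_zero).differentiableOn
    have hx1 : deriv T x = 1 := by
      rw [hxT]; simp [T]
    have : g (w + (Real.sqrt (2 - x) : ℝ)) ≠ 0 := by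
      have : q (w + (Real.sqrt (2 - x) : ℝ)) = x := by
        simp only [q, add_sub_cancel_left, Complex.ofReal_re, Complex.ofReal_im]
        rw [Real.sq_sqrt (by linarith [hx.2])]; ring
      simp [g, this, hx1]
    have := hgc.integral_pos_of_hasCompactSupport_nonneg_nonzero (μ := volume) hgs hg0 this
    exact_mod_cast this.ne'

lemma J_ne_zero {χ : ℂ → ℂ} (h₁ : ContDiff ℝ 1 χ) (c₁ : HasCompactSupport χ) {w : ℂ}
    (hw : w ∉ tsupport (fun x => 1 - χ x)) : ∫ ζ, dbar χ ζ * (w - ζ)⁻¹ ≠ 0 := by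
  obtain ⟨ρ, h₂, c₂, hw₂, hne⟩ := radial w
  rw [indep (U := {w}ᶜ) h₁ h₂ c₁ c₂]
  · exact hne
  · rintro x hx rfl; exact hw hx.2
  · rintro x hx rfl; exact hw₂ hx.2
  · rintro x hx rfl
    rcases hx.2 with h | h
    · exact hw h
    · exact hw₂ h
  · exact isOpen_compl_singleton
  · intro x hx
    have : w - x ≠ 0 := sub_ne_zero.2 (Ne.symm hx)
    exact ((differentiableAt_const w).sub differentiableAt_id).inv this |>.differentiableWithinAt

lemma diff_param {n : ℕ} {S : Set ℂ} (hS : IsCompact S) {H : (Fin n → ℂ) → ℂ → ℂ}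
    {O : Set (Fin n → ℂ)} (hO : IsOpen O) (hd : ∀ ζ ∈ S, DifferentiableOn ℂ (fun z => H z ζ) O)
    (hc : ContinuousOn (fun p : (Fin n → ℂ) × ℂ => H p.1 p.2) (O ×ˢ S)) {z₀ : Fin n → ℂ}
    (hz : z₀ ∈ O) : DifferentiableAt ℂ (fun z => ∫ ζ in S, H z ζ) z₀ := by
  obtain ⟨r, hr, hrO⟩ := Metric.nhds_basis_closedBall.mem_iff.1 (hO.mem_nhds hz)
  obtain ⟨M, hM⟩ := ((isCompact_closedBall z₀ r).prod hS).exists_bound_of_continuousOn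
    (hc.mono (prod_mono hrO subset_rfl))
  have hcz : ∀ z ∈ O, ContinuousOn (H z) S := fun z hz =>
    hc.comp (f := fun ζ => (z, ζ)) (by fun_prop) (fun ζ hζ => ⟨hz, hζ⟩)
  have hmeas : ∀ z ∈ O, AEStronglyMeasurable (H z) (volume.restrict S) := fun z hz =>
    (hcz z hz).aestronglyMeasurable hS.measurableSet
  have hder : ∀ ζ ∈ S, HasFDerivAt (fun z => H z ζ) (fderiv ℂ (fun z => H z ζ) z₀) z₀ :=
    fun ζ hζ => ((hd ζ hζ z₀ hz).differentiableAt (hO.mem_nhds hz)).hasFDerivAt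
  have hv : ∀ v, AEStronglyMeasurable (fun ζ => fderiv ℂ (fun z => H z ζ) z₀ v)
      (volume.restrict S) := by
    intro v
    let c : ℕ → ℝ := fun k => k + 1 + ‖v‖ / r
    have hcpos : ∀ k, 0 < c k := fun k => by positivity
    refine aestronglyMeasurable_of_tendsto_ae atTop
      (f := fun k ζ => ((c k : ℝ) : ℂ) • (H (z₀ + ((c k : ℝ) : ℂ)⁻¹ • v) ζ - H z₀ ζ)) ?_ ?_
    · intro k
      suffices hmem : z₀ + ((c k : ℝ) : ℂ)⁻¹ • v ∈ closedBall z₀ r by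
        exact ((hmeas _ (hrO hmem)).sub (hmeas _ hz)).const_smul ((c k : ℝ) : ℂ)
      rw [mem_closedBall, dist_eq_norm, add_sub_cancel_left, norm_smul, norm_inv,
        Complex.norm_real, Real.norm_of_nonneg (hcpos k).le, inv_mul_le_iff₀ (hcpos k)]
      have : c k * r = (k + 1) * r + ‖v‖ := by simp only [c]; field_simp
      rw [this]
      have : 0 ≤ ((k : ℝ) + 1) * r := by positivity
      linarith
    · refine (ae_restrict_iff' hS.measurableSet).2 (Eventually.of_forall fun ζ hζ => ?_)
      refine (hder ζ hζ).lim v ?_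
      have : ∀ k, ‖((c k : ℝ) : ℂ)‖ = c k := fun k => by
        rw [Complex.norm_real, Real.norm_of_nonneg (hcpos k).le]
      simp_rw [this]
      exact tendsto_atTop_add_const_right _ _
        (tendsto_atTop_add_const_right _ _ tendsto_natCast_atTop_atTop)
  have hF' : AEStronglyMeasurable (fun ζ => fderiv ℂ (fun z => H z ζ) z₀)
      (volume.restrict S) := by
    have e : ∀ L : (Fin n → ℂ) →L[ℂ] ℂ, L = ∑ i, L (Pi.single i 1) •
        (ContinuousLinearMap.proj i : (Fin n → ℂ) →L[ℂ] ℂ) := by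
      intro L
      ext x
      have hx : x = ∑ i, x i • (Pi.single i 1 : Fin n → ℂ) := by
        ext j; simp [Finset.sum_apply, Pi.single_apply]
      conv_lhs => rw [hx, map_sum]
      simp [mul_comm]
    have : (fun ζ => fderiv ℂ (fun z => H z ζ) z₀) = fun ζ => ∑ i,
        fderiv ℂ (fun z => H z ζ) z₀ (Pi.single i 1) •
        (ContinuousLinearMap.proj i : (Fin n → ℂ) →L[ℂ] ℂ) := by
      ext1 ζ; exact e _
    rw [this]
    exact Finset.aestronglyMeasurable_fun_sum _ fun i _ => (hv _).smul_const _
  have hfin : volume S ≠ ⊤ := hS.measure_lt_top.ne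
  refine (hasFDerivAt_integral_of_dominated_loc_of_lip' (bound := fun _ => 2 * M / r)
    (ball_mem_nhds z₀ hr)
    (fun z hz => hmeas z (hrO (ball_subset_closedBall hz)))
    ((hcz z₀ hz).integrableOn_compact hS) hF' ?_ ?_ ?_).2.differentiableAt
  · refine (ae_restrict_iff' hS.measurableSet).2 (Eventually.of_forall fun ζ hζ => ?_)
    intro z hz'
    have := Complex.dist_le_div_mul_dist_of_mapsTo_ball (f := fun z => H z ζ) (R₂ := 2 * M)
      ((hd ζ hζ).mono (ball_subset_closedBall.trans hrO)) (c := z₀) (R₁ := r) ?_ hz'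
    · simpa [dist_eq_norm] using this
    · intro y hy
      rw [mem_closedBall, dist_eq_norm]
      have h1 := hM (y, ζ) ⟨ball_subset_closedBall hy, hζ⟩
      have h2 := hM (z₀, ζ) ⟨mem_closedBall_self hr.le, hζ⟩
      have := norm_sub_le (H y ζ) (H z₀ ζ)
      simp only at h1 h2 ⊢
      linarith
  · exact integrableOn_const hfin
  · exact (ae_restrict_iff' hS.measurableSet).2 (Eventually.of_forall hder)

/-- `χ` is an admissible cutoff for the slice through `z` in direction `i`. -/
structure Adm {n : ℕ} (Ω K : Set (Fin n → ℂ)) (i : Fin n) (z : Fin n → ℂ) (χ : ℂ → ℂ) : Prop where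
  cd : ContDiff ℝ 1 χ
  cs : HasCompactSupport χ
  inn : ∀ ζ ∈ tsupport χ, Function.update z i ζ ∈ Ω
  out : ∀ ζ ∈ tsupport (fun x => 1 - χ x), Function.update z i ζ ∉ K
  ne : z i ∉ tsupport (fun x => 1 - χ x)

/-- The smoothed Cauchy integral. -/
noncomputable def cint {n : ℕ} (i : Fin n) (f : (Fin n → ℂ) → ℂ) (χ : ℂ → ℂ) (z : Fin n → ℂ) : ℂ :=
  ∫ ζ, dbar χ ζ * (f (Function.update z i ζ) * (z i - ζ)⁻¹)

variable {n : ℕ} {Ω K : Set (Fin n → ℂ)} {i : Fin n} {f : (Fin n → ℂ) → ℂ}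

lemma continuous_upd (z : Fin n → ℂ) (i : Fin n) : Continuous (fun ζ : ℂ => Function.update z i ζ) :=
  continuous_const.update i continuous_id

lemma continuous_upd2 (i : Fin n) :
    Continuous (fun p : (Fin n → ℂ) × ℂ => Function.update p.1 i p.2) :=
  continuous_fst.update i continuous_snd

lemma differentiable_upd (z : Fin n → ℂ) (i : Fin n) :
    Differentiable ℂ (fun ζ : ℂ => Function.update z i ζ) := by
  rw [differentiable_pi]
  intro j
  by_cases h : j = i
  · subst h; simp
  · simp [h]

lemma differentiable_upd' (ζ : ℂ) (i : Fin n) :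
    Differentiable ℂ (fun z : Fin n → ℂ => Function.update z i ζ) := by
  rw [differentiable_pi]
  intro j
  by_cases h : j = i
  · subst h; simp
  · simp only [Function.update_of_ne h]; fun_prop

/-- The slice. -/
def slice (Ω K : Set (Fin n → ℂ)) (i : Fin n) (z : Fin n → ℂ) : Set ℂ :=
  (fun ζ => Function.update z i ζ) ⁻¹' (Ω \ K) ∩ {z i}ᶜ

lemma isOpen_slice (hΩ : IsOpen Ω) (hK : IsCompact K) (z : Fin n → ℂ) :
    IsOpen (slice Ω K i z) :=
  ((hΩ.sdiff hK.isClosed).preimage (continuous_upd z i)).inter isOpen_compl_singleton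

lemma slice_diff (hf : DifferentiableOn ℂ f (Ω \ K)) (z : Fin n → ℂ) :
    DifferentiableOn ℂ (fun ζ => f (Function.update z i ζ) * (z i - ζ)⁻¹) (slice Ω K i z) := by
  refine DifferentiableOn.mul ?_ ?_
  · exact hf.comp (differentiable_upd z i).differentiableOn (fun ζ hζ => hζ.1)
  · intro ζ hζ
    have : z i - ζ ≠ 0 := sub_ne_zero.2 (Ne.symm hζ.2)
    exact ((differentiableAt_const (z i)).sub differentiableAt_id).inv this
      |>.differentiableWithinAt

lemma Adm.sub {z : Fin n → ℂ} {χ : ℂ → ℂ} (h : Adm Ω K i z χ) :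
    tsupport χ ∩ tsupport (fun x => 1 - χ x) ⊆ slice Ω K i z := by
  intro ζ hζ
  refine ⟨⟨h.inn ζ hζ.1, h.out ζ hζ.2⟩, ?_⟩
  rintro rfl
  exact h.ne hζ.2

lemma cint_indep (hΩ : IsOpen Ω) (hK : IsCompact K) (hf : DifferentiableOn ℂ f (Ω \ K))
    {z : Fin n → ℂ} {χ₁ χ₂ : ℂ → ℂ} (h₁ : Adm Ω K i z χ₁) (h₂ : Adm Ω K i z χ₂) :
    cint i f χ₁ z = cint i f χ₂ z := by
  refine indep h₁.cd h₂.cd h₁.cs h₂.cs h₁.sub h₂.sub ?_ (isOpen_slice hΩ hK z) (slice_diff hf z)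
  rintro ζ ⟨ha, hb⟩
  refine ⟨⟨ha.elim (h₁.inn ζ) (h₂.inn ζ), hb.elim (h₁.out ζ) (h₂.out ζ)⟩, ?_⟩
  rintro rfl
  exact hb.elim h₁.ne h₂.ne

lemma cint_one_ne {z : Fin n → ℂ} {χ : ℂ → ℂ} (h : Adm Ω K i z χ) :
    cint i (fun _ => 1) χ z ≠ 0 := by
  have := J_ne_zero h.cd h.cs h.ne
  simpa [cint] using this

lemma adm_open (hΩ : IsOpen Ω) (hK : IsCompact K) {z₀ : Fin n → ℂ} {χ : ℂ → ℂ}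
    (h : Adm Ω K i z₀ χ) : ∀ᶠ z in 𝓝 z₀, Adm Ω K i z χ := by
  have e1 : ∀ᶠ z in 𝓝 z₀, ∀ ζ ∈ tsupport χ, Function.update z i ζ ∈ Ω := by
    refine IsCompact.eventually_forall_of_forall_eventually (K := tsupport χ) h.cs ?_
    intro ζ hζ
    exact (continuous_upd2 i).continuousAt.eventually (hΩ.mem_nhds (h.inn ζ hζ))
  have e2 : ∀ᶠ z in 𝓝 z₀, ∀ k ∈ K ∩ (fun k => k i) ⁻¹' tsupport (fun x => 1 - χ x),
      Function.update z i (k i) ≠ k := by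
    refine IsCompact.eventually_forall_of_forall_eventually
      (hK.inter_right ((isClosed_tsupport _).preimage (continuous_apply i))) ?_
    rintro k ⟨hk, hki⟩
    have hne : Function.update z₀ i (k i) ≠ k := by
      intro he
      apply h.out (k i) hki
      rwa [he]
    have hcont : Continuous (fun p : (Fin n → ℂ) × (Fin n → ℂ) => Function.update p.1 i (p.2 i)) :=
      continuous_fst.update i ((continuous_apply i).comp continuous_snd)
    exact (isOpen_ne_fun hcont continuous_snd).mem_nhds hne
  have e3 : ∀ᶠ z in 𝓝 z₀, z i ∉ tsupport (fun x => 1 - χ x) :=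
    ((isClosed_tsupport _).isOpen_compl.preimage (continuous_apply i)).mem_nhds h.ne
  filter_upwards [e1, e2, e3] with z h1 h2 h3
  refine ⟨h.cd, h.cs, h1, ?_, h3⟩
  intro ζ hζ hk
  refine h2 _ ⟨hk, ?_⟩ ?_
  · simpa using hζ
  · simp

lemma adm_exists (hΩ : IsOpen Ω) (hK : IsCompact K) (hKΩ : K ⊆ Ω) {z : Fin n → ℂ} (hz : z ∈ Ω) :
    ∃ χ, Adm Ω K i z χ := by
  have hC : IsCompact ((fun ζ => Function.update z i ζ) ⁻¹' K) := by
    refine (hK.image (continuous_apply i)).of_isClosed_subset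
      (hK.isClosed.preimage (continuous_upd z i)) ?_
    intro ζ hζ
    exact ⟨_, hζ, by simp⟩
  obtain ⟨χ, h1, h2, h3, h4⟩ := exists_cutoff (hC.union (isCompact_singleton (x := z i)))
    (hΩ.preimage (continuous_upd z i)) (by
      rintro ζ (hζ | rfl)
      · exact hKΩ hζ
      · simpa using hz)
  refine ⟨χ, h1, h2, h3, ?_, ?_⟩
  · intro ζ hζ hk
    exact disjoint_left.1 h4 hζ (Or.inl hk)
  · intro hζ
    exact disjoint_left.1 h4 hζ (Or.inr rfl)

lemma cint_diff (hΩ : IsOpen Ω) (hK : IsCompact K) (hf : DifferentiableOn ℂ f (Ω \ K))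
    {z₀ : Fin n → ℂ} {χ : ℂ → ℂ} (h : Adm Ω K i z₀ χ) : DifferentiableAt ℂ (cint i f χ) z₀ := by
  have hO : IsOpen {z | Adm Ω K i z χ} := isOpen_iff_mem_nhds.2 fun z hz => adm_open hΩ hK hz
  set S := tsupport χ ∩ tsupport (fun x => 1 - χ x) with hSdef
  have hS : IsCompact S := IsCompact.inter_right h.cs (isClosed_tsupport _)
  have e : cint i f χ = fun z => ∫ ζ in S, dbar χ ζ * (f (Function.update z i ζ) * (z i - ζ)⁻¹) := by
    ext z
    symm
    refine setIntegral_eq_integral_of_forall_compl_eq_zero ?_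
    intro ζ hζ
    have : dbar χ ζ = 0 := by
      by_cases h1 : ζ ∈ tsupport χ
      · exact dbar_zero' fun h2 => hζ ⟨h1, h2⟩
      · exact dbar_zero h1
    rw [this, zero_mul]
  rw [e]
  have hU := hΩ.sdiff hK.isClosed
  have hne : ∀ z, Adm Ω K i z χ → ∀ ζ ∈ S, z i - ζ ≠ 0 := fun z hz ζ hζ =>
    sub_ne_zero.2 (Ne.symm (hz.sub hζ).2)
  refine diff_param hS hO ?_ ?_ (show z₀ ∈ {z | Adm Ω K i z χ} from h)
  · intro ζ hζ z hz
    refine DifferentiableAt.differentiableWithinAt ?_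
    refine (differentiableAt_const _).mul (DifferentiableAt.mul ?_ (DifferentiableAt.inv ?_ ?_))
    · have h1 : DifferentiableAt ℂ f (Function.update z i ζ) :=
        (hf _ (Adm.sub hz hζ).1).differentiableAt (hU.mem_nhds (Adm.sub hz hζ).1)
      exact h1.comp z (differentiable_upd' ζ i z)
    · fun_prop
    · exact hne z hz ζ hζ
  · refine ContinuousOn.mul ((dbar_continuous h.cd).comp continuous_snd).continuousOn
      (ContinuousOn.mul ?_ (ContinuousOn.inv₀ ?_ ?_))
    · exact hf.continuousOn.comp (continuous_upd2 i).continuousOn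
        (fun p hp => (Adm.sub hp.1 hp.2).1)
    · fun_prop
    · exact fun p hp => hne p.1 hp.1 p.2 hp.2

lemma cint_eq (hΩ : IsOpen Ω) (hK : IsCompact K) (hf : DifferentiableOn ℂ f (Ω \ K))
    {z : Fin n → ℂ} (hz : z ∈ Ω) {χ : ℂ → ℂ} (h : Adm Ω K i z χ)
    (hm : ∀ ζ, Function.update z i ζ ∉ K) :
    cint i f χ z = f z * cint i (fun _ => 1) χ z := by
  let g : ℂ → ℂ := fun ζ => f (Function.update z i ζ)
  let U : Set ℂ := (fun ζ => Function.update z i ζ) ⁻¹' Ω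
  have hU : IsOpen U := hΩ.preimage (continuous_upd z i)
  have hg : DifferentiableOn ℂ g U :=
    hf.comp (differentiable_upd z i).differentiableOn (fun ζ hζ => ⟨hζ, hm ζ⟩)
  have hzU : z i ∈ U := by simpa [U] using hz
  have hgz : g (z i) = f z := by simp [g]
  have hds := (Complex.differentiableOn_dslope (hU.mem_nhds hzU)).2 hg
  have h0 := stokes hU hds h.cd h.cs h.inn
  have i1 := dbar_integrable h.cd h.cs h.sub (isOpen_slice hΩ hK z)
    (slice_diff (f := fun _ => (1 : ℂ)) (differentiableOn_const _) z).continuousOn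
  have i2 : Integrable (fun ζ => dbar χ ζ * dslope g (z i) ζ) :=
    dbar_integrable h.cd h.cs (fun ζ hζ => h.inn ζ hζ.1) hU hds.continuousOn
  have e : ∀ ζ, dbar χ ζ * (f (Function.update z i ζ) * (z i - ζ)⁻¹) =
      f z * (dbar χ ζ * (1 * (z i - ζ)⁻¹)) - dbar χ ζ * dslope g (z i) ζ := by
    intro ζ
    by_cases hζ : ζ = z i
    · subst hζ
      simp [dbar_zero' h.ne]
    · rw [dslope_of_ne _ hζ, slope_def_field, hgz]
      have a : z i - ζ ≠ 0 := sub_ne_zero.2 (Ne.symm hζ)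
      have b : ζ - z i ≠ 0 := sub_ne_zero.2 hζ
      change dbar χ ζ * (g ζ * (z i - ζ)⁻¹) = _
      rw [← neg_sub (z i) ζ]
      field_simp
      ring
  unfold cint
  simp_rw [e]
  rw [integral_sub (i1.const_mul _) i2, h0, sub_zero, integral_const_mul]

lemma main_ext (hΩ : IsOpen Ω) (hK : IsCompact K) (hKΩ : K ⊆ Ω) (i : Fin n)
    (hf : DifferentiableOn ℂ f (Ω \ K)) : ∃ F : (Fin n → ℂ) → ℂ, DifferentiableOn ℂ F Ω ∧
      ∀ z ∈ Ω, (∀ ζ, Function.update z i ζ ∉ K) → F z = f z := by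
  have hex : ∀ z, ∃ χ : ℂ → ℂ, z ∈ Ω → Adm Ω K i z χ := fun z => by
    by_cases hz : z ∈ Ω
    · obtain ⟨χ, h⟩ := adm_exists (i := i) hΩ hK hKΩ hz
      exact ⟨χ, fun _ => h⟩
    · exact ⟨0, fun h => absurd h hz⟩
  choose X hX using hex
  have h1 : DifferentiableOn ℂ (fun _ : Fin n → ℂ => (1 : ℂ)) (Ω \ K) := differentiableOn_const _
  refine ⟨fun z => cint i f (X z) z / cint i (fun _ => 1) (X z) z, ?_, ?_⟩
  · intro z₀ hz₀
    refine DifferentiableAt.differentiableWithinAt ?_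
    have ha := hX z₀ hz₀
    have := (cint_diff hΩ hK hf ha).mul ((cint_diff hΩ hK h1 ha).inv (cint_one_ne ha))
    refine this.congr_of_eventuallyEq ?_
    filter_upwards [adm_open hΩ hK ha, hΩ.mem_nhds hz₀] with z hz hzΩ
    simp only [Pi.mul_apply, Pi.inv_apply, div_eq_mul_inv]
    rw [cint_indep hΩ hK hf (hX z hzΩ) hz, cint_indep hΩ hK h1 (hX z hzΩ) hz]
  · intro z hz hm
    simp only
    rw [cint_eq hΩ hK hf hz (hX z hz) hm, mul_div_cancel_right₀ _ (cint_one_ne (hX z hz))]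

end Hartogs

theorem hartogs_extension (n : ℕ) (hn : 2 ≤ n)
    (Ω K : Set (Fin n → ℂ)) (hΩ : IsOpen Ω) (hK : IsCompact K) (hKΩ : K ⊆ Ω)
    (hconn : IsConnected (Ω \ K)) (f : (Fin n → ℂ) → ℂ)
    (hf : DifferentiableOn ℂ f (Ω \ K)) :
    (∃ F : (Fin n → ℂ) → ℂ, DifferentiableOn ℂ F Ω ∧ Set.EqOn F f (Ω \ K)) ∧
      ∀ F₁ F₂ : (Fin n → ℂ) → ℂ,
        DifferentiableOn ℂ F₁ Ω → Set.EqOn F₁ f (Ω \ K) →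
        DifferentiableOn ℂ F₂ Ω → Set.EqOn F₂ f (Ω \ K) →
        Set.EqOn F₁ F₂ Ω := by
  let i₀ : Fin n := ⟨0, by omega⟩
  let i₁ : Fin n := ⟨1, by omega⟩
  have hi : i₁ ≠ i₀ := by simp [i₀, i₁]
  constructor
  · rcases K.eq_empty_or_nonempty with rfl | hne
    · exact ⟨f, by simpa using hf, fun _ _ => rfl⟩
    obtain ⟨F, hF, hFf⟩ := Hartogs.main_ext hΩ hK hKΩ i₀ hf
    refine ⟨F, hF, ?_⟩
    have hre : Continuous (fun z : Fin n → ℂ => (z i₁).re) :=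
      Complex.continuous_re.comp (continuous_apply i₁)
    obtain ⟨p, hpK, hp⟩ := hK.exists_isMaxOn hne hre.continuousOn
    let V : Set (Fin n → ℂ) := Ω ∩ {z | (p i₁).re < (z i₁).re}
    have hV : IsOpen V := hΩ.inter (isOpen_lt continuous_const hre)
    have hVF : ∀ z ∈ V, z ∉ K ∧ F z = f z := by
      rintro z ⟨hz, hlt⟩
      have hlt' : (p i₁).re < (z i₁).re := hlt
      refine ⟨fun h => ?_, hFf z hz fun ζ h => ?_⟩
      · exact absurd (hp h) (not_le.2 hlt')
      · have h2 : (Function.update z i₀ ζ i₁).re ≤ (p i₁).re := hp h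
        rw [Function.update_of_ne hi] at h2
        exact absurd h2 (not_le.2 hlt')
    have hcont : Continuous (fun t : ℝ => Function.update p i₁ (p i₁ + (t : ℂ))) :=
      continuous_const.update i₁ (by fun_prop)
    have hev : ∀ᶠ t : ℝ in 𝓝 0, Function.update p i₁ (p i₁ + (t : ℂ)) ∈ Ω := by
      refine hcont.continuousAt.eventually (hΩ.mem_nhds ?_)
      simpa using hKΩ hpK
    obtain ⟨t, htΩ, ht⟩ := ((hev.filter_mono nhdsWithin_le_nhds).and
      (self_mem_nhdsWithin (a := (0 : ℝ)) (s := Ioi 0))).exists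
    have hq : Function.update p i₁ (p i₁ + (t : ℂ)) ∈ V := by
      refine ⟨htΩ, ?_⟩
      have : (0 : ℝ) < t := ht
      simpa using this
    refine Hartogs.identity (hΩ.sdiff hK.isClosed) hconn.isPreconnected (hF.mono sdiff_subset) hf
      (a := Function.update p i₁ (p i₁ + (t : ℂ))) ⟨htΩ, (hVF _ hq).1⟩ ?_
    filter_upwards [hV.mem_nhds hq] with z hz
    exact (hVF z hz).2
  · intro F₁ F₂ h₁ e₁ h₂ e₂
    have : Nonempty (Fin n) := ⟨i₀⟩
    have : NoncompactSpace (Fin n → ℂ) := NormedSpace.noncompactSpace ℂ _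
    exact Hartogs.uniq hΩ hK hKΩ h₁ h₂ (e₁.trans e₂.symm)
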